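/- Let N ≥ 1, let C ⊆ ℝ^N be a properly convex open cone with dual cone C*, and let Γ be a subgroup of GL(N, ℝ) with g(C) = C for all g ∈ Γ. Then the following are equivalent: (a) there exists a compact subset K ⊆ C such that C = ⋃ { s·g(K) : g ∈ Γ, s > 0 }; (b) there exists a compact subset K' ⊆ C* such that C* = ⋃ { s·(gᵀ)⁻¹(K') : g ∈ Γ, s > 0 }. -/

import Mathlib

open Matrix

/-- A properly convex open cone in `ℝ^N`: a nonempty open convex cone containing
no complete affine line. -/
def IsProperConvexOpenCone (N : ℕ) (C : Set (Fin N → ℝ)) : Prop :=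
  C.Nonempty ∧ IsOpen C ∧ Convex ℝ C ∧
    (∀ x ∈ C, ∀ t : ℝ, 0 < t → t • x ∈ C) ∧
    ¬ ∃ (x v : Fin N → ℝ), v ≠ 0 ∧ ∀ t : ℝ, x + t • v ∈ C

/-- The dual cone `C* = {y | ⟨y, x⟩ > 0 for all x ∈ closure C \ {0}}`, where the
standard inner product is realized as the dot product on `Fin N → ℝ`. -/
def dualConeSet (N : ℕ) (C : Set (Fin N → ℝ)) : Set (Fin N → ℝ) :=
  {y | ∀ x ∈ closure C, x ≠ 0 → 0 < dotProduct y x}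

section ConeGeometry

variable {N : ℕ} {C : Set (Fin N → ℝ)}

lemma IsProperConvexOpenCone.smul_mem_closure (hC : IsProperConvexOpenCone N C)
    {x : Fin N → ℝ} (hx : x ∈ closure C) {t : ℝ} (ht : 0 < t) : t • x ∈ closure C :=
  map_mem_closure (continuous_const_smul t) hx fun a ha => hC.2.2.2.1 a ha t ht

lemma IsProperConvexOpenCone.add_mem (hC : IsProperConvexOpenCone N C)
    {x y : Fin N → ℝ} (hx : x ∈ C) (hy : y ∈ closure C) : x + y ∈ C := by
  have h := hC.2.2.1.combo_interior_closure_mem_interior (hC.2.1.interior_eq.symm ▸ hx) hy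
    (a := 1 / 2) (b := 1 / 2) (by norm_num) (by norm_num) (by norm_num)
  rw [hC.2.1.interior_eq] at h
  have h2 := hC.2.2.2.1 _ h 2 (by norm_num)
  rwa [smul_add, smul_smul, smul_smul, show (2 : ℝ) * (1 / 2) = 1 by norm_num, one_smul,
    one_smul] at h2

lemma IsProperConvexOpenCone.add_mem_closure (hC : IsProperConvexOpenCone N C)
    {x y : Fin N → ℝ} (hx : x ∈ closure C) (hy : y ∈ closure C) : x + y ∈ closure C :=
  map_mem_closure (f := fun a => a + y) (continuous_add_const y) hx fun _ ha =>
    hC.add_mem ha hy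

lemma IsProperConvexOpenCone.zero_mem_closure (hC : IsProperConvexOpenCone N C) :
    (0 : Fin N → ℝ) ∈ closure C := by
  obtain ⟨x, hx⟩ := hC.1
  have h : Filter.Tendsto (fun t : ℝ => t • x) (nhdsWithin 0 (Set.Ioi 0)) (nhds 0) := by
    have : Continuous fun t : ℝ => t • x := by fun_prop
    simpa using (this.tendsto 0).mono_left nhdsWithin_le_nhds
  exact mem_closure_of_tendsto h
    (Filter.eventually_of_mem self_mem_nhdsWithin fun t ht => hC.2.2.2.1 x hx t ht)

lemma IsProperConvexOpenCone.sum_smul_mem_closure (hC : IsProperConvexOpenCone N C)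
    {ι : Type*} (s : Finset ι) (c : ι → ℝ) (v : ι → Fin N → ℝ) (hc : ∀ i ∈ s, 0 ≤ c i)
    (hv : ∀ i ∈ s, v i ∈ closure C) : ∑ i ∈ s, c i • v i ∈ closure C := by
  refine Finset.sum_induction _ (· ∈ closure C) (fun _ _ => hC.add_mem_closure)
    hC.zero_mem_closure fun i hi => ?_
  rcases (hc i hi).eq_or_lt with h | h
  · simpa [← h] using hC.zero_mem_closure
  · exact hC.smul_mem_closure (hv i hi) h

lemma IsProperConvexOpenCone.eq_zero_of_neg_mem (hC : IsProperConvexOpenCone N C)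
    {v : Fin N → ℝ} (hv : v ∈ closure C) (hv' : -v ∈ closure C) : v = 0 := by
  by_contra h
  obtain ⟨x, hx⟩ := hC.1
  refine hC.2.2.2.2 ⟨x, v, h, fun t => hC.add_mem hx ?_⟩
  rcases lt_trichotomy t 0 with ht | rfl | ht
  · simpa using hC.smul_mem_closure hv' (neg_pos.2 ht)
  · simpa using hC.zero_mem_closure
  · exact hC.smul_mem_closure hv ht

lemma exists_dotProduct_eq (f : StrongDual ℝ (Fin N → ℝ)) :
    ∃ y : Fin N → ℝ, ∀ x, f x = y ⬝ᵥ x := by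
  refine ⟨fun i => f (Pi.single i 1), fun x => ?_⟩
  conv_lhs => rw [← Finset.univ_sum_single x]
  rw [map_sum, dotProduct]
  refine Finset.sum_congr rfl fun i _ => ?_
  rw [mul_comm, ← smul_eq_mul, ← map_smul, ← Pi.single_smul, smul_eq_mul, mul_one]

lemma continuous_dotProduct_right (y : Fin N → ℝ) : Continuous fun x => y ⬝ᵥ x :=
  continuous_const.dotProduct continuous_id

/-- If every functional in a ball around `y` is nonnegative at `x`, the norm of `x` is
controlled by `y ⬝ᵥ x`. -/
lemma mul_norm_le_dotProduct {x y : Fin N → ℝ} {r : ℝ} (hr : 0 < r)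
    (h : ∀ y' ∈ Metric.closedBall y r, 0 ≤ y' ⬝ᵥ x) : r * ‖x‖ ≤ y ⬝ᵥ x := by
  have key : ∀ (i : Fin N) (c : ℝ), |c| ≤ r → 0 ≤ y ⬝ᵥ x + c * x i := by
    intro i c hc
    have := h (y + Pi.single i c) (by
      rw [mem_closedBall_iff_norm, add_sub_cancel_left, Pi.norm_single]
      exact hc)
    rwa [add_dotProduct, single_dotProduct] at this
  rw [mul_comm, ← le_div_iff₀ hr, pi_norm_le_iff_of_nonneg
    (div_nonneg (h y (Metric.mem_closedBall_self hr.le)) hr.le)]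
  intro i
  rw [le_div_iff₀ hr, Real.norm_eq_abs]
  have h1 := key i r (abs_of_pos hr).le
  have h2 := key i (-r) (by rw [abs_neg, abs_of_pos hr])
  rcases abs_cases (x i) with h | h <;> rw [h.1] <;> linarith

lemma dotProduct_nonneg_of_mem_closure {y x : Fin N → ℝ} (hy : ∀ a ∈ C, 0 ≤ y ⬝ᵥ a)
    (hx : x ∈ closure C) : 0 ≤ y ⬝ᵥ x :=
  closure_minimal (t := {a | 0 ≤ y ⬝ᵥ a}) hy
    (isClosed_le continuous_const (continuous_dotProduct_right y)) hx

lemma nonneg_of_mem_dualConeSet {y x : Fin N → ℝ} (hy : y ∈ dualConeSet N C)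
    (hx : x ∈ closure C) : 0 ≤ y ⬝ᵥ x := by
  by_cases h : x = 0
  · simp [h]
  · exact (hy x hx h).le

/-- A linear functional bounded below on a cone is nonnegative there. -/
lemma IsProperConvexOpenCone.nonneg_of_bddBelow (hC : IsProperConvexOpenCone N C)
    {y : Fin N → ℝ} {u : ℝ} (h : ∀ a ∈ C, u ≤ y ⬝ᵥ a) : ∀ a ∈ C, 0 ≤ y ⬝ᵥ a := by
  intro a ha
  by_contra! hneg
  have := h _ (hC.2.2.2.1 a ha ((|u| + 1) / -(y ⬝ᵥ a))
    (div_pos (by positivity) (neg_pos.2 hneg)))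
  rw [dotProduct_smul, smul_eq_mul, div_mul_eq_mul_div, div_neg, mul_div_cancel_right₀ _ hneg.ne]
    at this
  linarith [neg_abs_le u]

lemma IsProperConvexOpenCone.exists_pos (hC : IsProperConvexOpenCone N C)
    {x : Fin N → ℝ} (hx : x ∈ closure C) (hx0 : x ≠ 0) :
    ∃ y : Fin N → ℝ, (∀ a ∈ closure C, 0 ≤ y ⬝ᵥ a) ∧ 0 < y ⬝ᵥ x := by
  have hn : -x ∉ closure C := fun h => hx0 (hC.eq_zero_of_neg_mem hx h)
  obtain ⟨f, u, h1, h2⟩ := geometric_hahn_banach_point_closed hC.2.2.1.closure isClosed_closure hn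
  obtain ⟨y, hy⟩ := exists_dotProduct_eq f
  have hu : u < 0 := by simpa using h2 0 hC.zero_mem_closure
  refine ⟨y, fun a ha => dotProduct_nonneg_of_mem_closure (hC.nonneg_of_bddBelow
    fun b hb => (hy b ▸ h2 b (subset_closure hb)).le) ha, ?_⟩
  rw [hy, dotProduct_neg] at h1
  linarith

lemma isCompact_sphere_inter_closure (C : Set (Fin N → ℝ)) :
    IsCompact (Metric.sphere 0 1 ∩ closure C) :=
  (isCompact_sphere 0 1).inter_right isClosed_closure

lemma IsProperConvexOpenCone.mem_dualConeSet_iff (hC : IsProperConvexOpenCone N C)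
    {y : Fin N → ℝ} :
    y ∈ dualConeSet N C ↔ ∀ x ∈ Metric.sphere 0 1 ∩ closure C, 0 < y ⬝ᵥ x := by
  refine ⟨fun h x hx => h x hx.2 (ne_zero_of_mem_unit_sphere ⟨x, hx.1⟩), fun h x hx hx0 => ?_⟩
  have hp : 0 < ‖x‖ := norm_pos_iff.2 hx0
  have := h (‖x‖⁻¹ • x) ⟨by simp [norm_smul, hp.ne'], hC.smul_mem_closure hx (inv_pos.2 hp)⟩
  rw [dotProduct_smul, smul_eq_mul] at this
  exact pos_of_mul_pos_right this (inv_pos.2 hp).le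

lemma IsProperConvexOpenCone.dual_nonempty (hC : IsProperConvexOpenCone N C) :
    (dualConeSet N C).Nonempty := by
  have h : ∃ y : Fin N → ℝ, (∀ a ∈ closure C, 0 ≤ y ⬝ᵥ a) ∧
      ∀ x ∈ Metric.sphere 0 1 ∩ closure C, x ∈ closure C → 0 < y ⬝ᵥ x := by
    refine (isCompact_sphere_inter_closure C).induction_on
      (p := fun s => ∃ y : Fin N → ℝ, (∀ a ∈ closure C, 0 ≤ y ⬝ᵥ a) ∧
        ∀ x ∈ s, x ∈ closure C → 0 < y ⬝ᵥ x) ⟨0, by simp⟩ ?_ ?_ ?_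
    · rintro s t hst ⟨y, hy, h⟩
      exact ⟨y, hy, fun x hx => h x (hst hx)⟩
    · rintro s t ⟨y, hy, h⟩ ⟨z, hz, h'⟩
      refine ⟨y + z, fun a ha => ?_, fun x hx hxC => ?_⟩
      · rw [add_dotProduct]
        exact add_nonneg (hy a ha) (hz a ha)
      · rw [add_dotProduct]
        rcases hx with hx | hx
        · exact add_pos_of_pos_of_nonneg (h x hx hxC) (hz x hxC)
        · exact add_pos_of_nonneg_of_pos (hy x hxC) (h' x hx hxC)
    · intro x hx
      obtain ⟨y, hy, hyx⟩ := hC.exists_pos hx.2 (ne_zero_of_mem_unit_sphere ⟨x, hx.1⟩)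
      exact ⟨{z | 0 < y ⬝ᵥ z}, mem_nhdsWithin_of_mem_nhds
        ((isOpen_lt continuous_const (continuous_dotProduct_right y)).mem_nhds hyx),
        y, hy, fun z hz _ => hz⟩
  obtain ⟨y, -, hy⟩ := h
  exact ⟨y, hC.mem_dualConeSet_iff.2 fun x hx => hy x hx hx.2⟩

lemma IsProperConvexOpenCone.isOpen_dual (hC : IsProperConvexOpenCone N C) :
    IsOpen (dualConeSet N C) := by
  rw [isOpen_iff_mem_nhds]
  intro y hy
  have := (isCompact_sphere_inter_closure C).eventually_forall_of_forall_eventually (x₀ := y)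
    (P := fun y x => 0 < y ⬝ᵥ x) fun x hx =>
      (isOpen_lt continuous_const (continuous_fst.dotProduct continuous_snd)).mem_nhds
        (hC.mem_dualConeSet_iff.1 hy x hx)
  filter_upwards [this] with z hz using hC.mem_dualConeSet_iff.2 hz

/-- A nonzero functional nonnegative on an open set is positive there. -/
lemma pos_of_nonneg_of_isOpen (hC : IsOpen C) {y x : Fin N → ℝ} (hx : x ∈ C) (hy0 : y ≠ 0)
    (hy : ∀ a ∈ C, 0 ≤ y ⬝ᵥ a) : 0 < y ⬝ᵥ x := by
  obtain ⟨r, hr, hb⟩ := Metric.nhds_basis_closedBall.mem_iff.1 (hC.mem_nhds hx)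
  have := mul_norm_le_dotProduct (x := y) (y := x) hr fun z hz => by
    rw [dotProduct_comm]
    exact hy z (hb hz)
  rw [dotProduct_comm]
  exact (mul_pos hr (norm_pos_iff.2 hy0)).trans_le this

lemma IsProperConvexOpenCone.dual (hC : IsProperConvexOpenCone N C) :
    IsProperConvexOpenCone N (dualConeSet N C) := by
  refine ⟨hC.dual_nonempty, hC.isOpen_dual, ?_, ?_, ?_⟩
  · intro y hy z hz a b ha hb hab x hx hx0
    have h1 := hy x hx hx0
    have h2 := hz x hx hx0
    rw [add_dotProduct, smul_dotProduct, smul_dotProduct, smul_eq_mul, smul_eq_mul]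
    rcases ha.eq_or_lt with rfl | ha
    · obtain rfl : b = 1 := by linarith
      linarith
    · positivity
  · intro y hy t ht x hx hx0
    rw [smul_dotProduct]
    exact mul_pos ht (hy x hx hx0)
  · rintro ⟨y, v, hv, h⟩
    have hzero : ∀ x ∈ C, v ⬝ᵥ x = 0 := by
      intro x hx
      by_contra h0
      have := nonneg_of_mem_dualConeSet (h (-(y ⬝ᵥ x + 1) / (v ⬝ᵥ x))) (subset_closure hx)
      rw [add_dotProduct, smul_dotProduct, smul_eq_mul, div_mul_cancel₀ _ h0] at this
      linarith
    obtain ⟨x, hx⟩ := hC.1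
    exact (pos_of_nonneg_of_isOpen hC.2.1 hx hv fun a ha => (hzero a ha).ge).ne' (hzero x hx)

lemma IsProperConvexOpenCone.dual_dual (hC : IsProperConvexOpenCone N C) :
    dualConeSet N (dualConeSet N C) = C := by
  ext x
  constructor
  · intro hx
    by_contra hxC
    obtain ⟨f, hf⟩ := geometric_hahn_banach_open_point hC.2.2.1 hC.2.1 hxC
    obtain ⟨y, hy⟩ := exists_dotProduct_eq (-f)
    have hlt : ∀ a ∈ C, y ⬝ᵥ x < y ⬝ᵥ a := fun a ha => by
      rw [← hy, ← hy]
      exact neg_lt_neg (hf a ha)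
    have hpos : ∀ a ∈ C, 0 ≤ y ⬝ᵥ a := hC.nonneg_of_bddBelow fun a ha => (hlt a ha).le
    have hle : y ⬝ᵥ x ≤ 0 :=
      closure_minimal (t := {a | y ⬝ᵥ x ≤ y ⬝ᵥ a}) (fun a ha => (hlt a ha).le)
        (isClosed_le continuous_const (continuous_dotProduct_right y)) hC.zero_mem_closure
        |>.trans (by simp)
    obtain ⟨a, ha⟩ := hC.1
    have hy0 : y ≠ 0 := by
      rintro rfl
      simpa using hlt a ha
    obtain ⟨w, hw⟩ := hC.dual_nonempty
    have hycl : y ∈ closure (dualConeSet N C) := by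
      have h : Filter.Tendsto (fun t : ℝ => y + t • w) (nhdsWithin 0 (Set.Ioi 0)) (nhds y) := by
        have : Continuous fun t : ℝ => y + t • w := by fun_prop
        simpa using (this.tendsto 0).mono_left nhdsWithin_le_nhds
      refine mem_closure_of_tendsto h
        (Filter.eventually_of_mem self_mem_nhdsWithin fun t ht z hz hz0 => ?_)
      rw [add_dotProduct, smul_dotProduct]
      exact add_pos_of_nonneg_of_pos (dotProduct_nonneg_of_mem_closure hpos hz)
        (mul_pos ht (hw z hz hz0))
    have := hx y hycl hy0
    rw [dotProduct_comm] at this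
    linarith
  · intro hx y hy hy0
    have h : ∀ a ∈ C, 0 ≤ y ⬝ᵥ a := fun a ha => by
      rw [dotProduct_comm]
      exact dotProduct_nonneg_of_mem_closure
        (fun z hz => dotProduct_comm a z ▸ nonneg_of_mem_dualConeSet hz (subset_closure ha)) hy
    rw [dotProduct_comm]
    exact pos_of_nonneg_of_isOpen hC.2.1 hx hy0 h

/-- The slice of a closed cone by an interior functional of the dual cone is compact. -/
lemma IsProperConvexOpenCone.isCompact_slice (hC : IsProperConvexOpenCone N C)
    {y : Fin N → ℝ} (hy : y ∈ dualConeSet N C) :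
    IsCompact {x | x ∈ closure C ∧ y ⬝ᵥ x = 1} := by
  obtain ⟨r, hr, hb⟩ := Metric.nhds_basis_closedBall.mem_iff.1 (hC.isOpen_dual.mem_nhds hy)
  refine (isCompact_closedBall (0 : Fin N → ℝ) (1 / r)).of_isClosed_subset
    (isClosed_closure.inter (isClosed_eq (continuous_dotProduct_right y) continuous_const))
    fun x hx => ?_
  have := mul_norm_le_dotProduct hr fun z hz => nonneg_of_mem_dualConeSet (hb hz) hx.1
  rw [hx.2] at this
  rwa [mem_closedBall_zero_iff, le_div_iff₀ hr, mul_comm]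

lemma exists_det_ne_zero_of_isOpen (hC : IsOpen C) (hne : C.Nonempty) :
    ∃ M : Matrix (Fin N) (Fin N) ℝ, (∀ i, M i ∈ C) ∧ M.det ≠ 0 := by
  have hspan : Submodule.span ℝ C = ⊤ := by
    refine Submodule.eq_top_of_nonempty_interior' _ (hne.mono ?_)
    exact interior_maximal Submodule.subset_span hC
  let b := Module.Basis.ofSpan hspan.ge
  let e := b.reindex (b.indexEquiv (Pi.basisFun ℝ (Fin N)))
  refine ⟨Matrix.of e, fun i => ?_, ?_⟩
  · refine Module.Basis.ofSpan_subset hspan.ge ?_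
    change e i ∈ _
    rw [Module.Basis.reindex_apply]
    exact Set.mem_range_self _
  · have := ((Pi.basisFun ℝ (Fin N)).isUnit_det e).ne_zero
    rwa [Pi.basisFun_det_apply] at this

/-- Each `y` in the dual cone admits a point of the cone that is uniformly central in the slices
of the cone by `y`: the barycentre of a simplex of maximal volume. -/
lemma IsProperConvexOpenCone.exists_central (hN : 1 ≤ N) (hC : IsProperConvexOpenCone N C)
    {y : Fin N → ℝ} (hy : y ∈ dualConeSet N C) :
    ∃ x ∈ C, 0 < y ⬝ᵥ x ∧
      ∀ z ∈ closure C, (y ⬝ᵥ z) • x - ((N : ℝ)⁻¹ * (y ⬝ᵥ x)) • z ∈ closure C := by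
  have hN0 : (0 : ℝ) < N := by exact_mod_cast hN
  obtain ⟨A, hA, hAdet⟩ := exists_det_ne_zero_of_isOpen hC.2.1 hC.1
  have hy0 : y ≠ 0 := by
    rintro rfl
    refine hAdet (Matrix.det_eq_zero_of_row_eq_zero ⟨0, hN⟩ fun j => ?_)
    by_contra hj
    simpa using hy (A ⟨0, hN⟩) (subset_closure (hA _)) fun h => hj (congrFun h j)
  have hyC : ∀ x ∈ C, 0 < y ⬝ᵥ x := fun x hx => pos_of_nonneg_of_isOpen hC.2.1 hx hy0
    fun a ha => nonneg_of_mem_dualConeSet hy (subset_closure ha)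
  let S : Set (Fin N → ℝ) := {x | x ∈ closure C ∧ y ⬝ᵥ x = 1}
  let T : Set (Matrix (Fin N) (Fin N) ℝ) := Set.pi Set.univ fun _ => S
  have hT : IsCompact T := isCompact_univ_pi fun _ => hC.isCompact_slice hy
  let A' : Matrix (Fin N) (Fin N) ℝ := Matrix.of fun i j => (y ⬝ᵥ A i)⁻¹ * A i j
  have hA'T : A' ∈ T := by
    intro i _
    have hrow : A' i = (y ⬝ᵥ A i)⁻¹ • A i := rfl
    have hp := hyC _ (hA i)
    rw [hrow]
    refine ⟨hC.smul_mem_closure (subset_closure (hA i)) (inv_pos.2 hp), ?_⟩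
    rw [dotProduct_smul, smul_eq_mul, inv_mul_cancel₀ hp.ne']
  have hA'det : A'.det ≠ 0 := by
    rw [Matrix.det_mul_column]
    exact mul_ne_zero (Finset.prod_ne_zero_iff.2 fun i _ => inv_ne_zero (hyC _ (hA i)).ne') hAdet
  obtain ⟨M, hMT, hmax⟩ := hT.exists_isMaxOn ⟨A', hA'T⟩
    (f := fun M : Matrix (Fin N) (Fin N) ℝ => |M.det|)
    (continuous_id.matrix_det.abs).continuousOn
  have hdet : M.det ≠ 0 := by
    have : |A'.det| ≤ |M.det| := hmax hA'T
    exact abs_pos.1 ((abs_pos.2 hA'det).trans_le this)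
  have hM : ∀ i, M i ∈ closure C ∧ y ⬝ᵥ M i = 1 := fun i => hMT i (Set.mem_univ i)
  set x : Fin N → ℝ := ∑ i, (N : ℝ)⁻¹ • M i with hx
  have hyx : y ⬝ᵥ x = 1 := by
    simp [hx, dotProduct_sum, dotProduct_smul, (hM _).2, hN0.ne']
  have hcentral : ∀ z ∈ S, x - (N : ℝ)⁻¹ • z ∈ closure C := by
    intro z hz
    have hle : ∀ i, |Matrix.cramer Mᵀ z i| ≤ |M.det| := by
      intro i
      rw [Matrix.cramer_transpose_apply]
      refine hmax (a := M.updateRow i z) fun j _ => ?_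
      by_cases hj : j = i
      · subst hj
        simpa using hz
      · rw [Matrix.updateRow_ne hj]
        exact hM j
    have hzsum : z = ∑ i, (Matrix.cramer Mᵀ z i / M.det) • M i := by
      have h := Matrix.mulVec_cramer Mᵀ z
      rw [Matrix.det_transpose, Matrix.mulVec_transpose, Matrix.vecMul_eq_sum] at h
      simp only [div_eq_inv_mul, ← smul_smul]
      rw [← Finset.smul_sum]
      exact (inv_smul_smul₀ hdet z).symm.trans (congrArg _ h.symm)
    have hsum : x - (N : ℝ)⁻¹ • z =
        ∑ i, ((N : ℝ)⁻¹ * (1 - Matrix.cramer Mᵀ z i / M.det)) • M i := by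
      conv_lhs => rw [hzsum, hx, Finset.smul_sum, ← Finset.sum_sub_distrib]
      refine Finset.sum_congr rfl fun i _ => ?_
      rw [smul_smul, ← sub_smul, mul_sub, mul_one]
    rw [hsum]
    refine hC.sum_smul_mem_closure _ _ _ (fun i _ => ?_) fun i _ => (hM i).1
    refine mul_nonneg (inv_pos.2 hN0).le (sub_nonneg.2 ((le_abs_self _).trans ?_))
    rw [abs_div]
    exact div_le_one_of_le₀ (hle i) (abs_nonneg _)
  have hscaled : ∀ z ∈ closure C, z ≠ 0 →
      (y ⬝ᵥ z) • x - (N : ℝ)⁻¹ • z ∈ closure C := by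
    intro z hz hz0
    have hp := hy z hz hz0
    have h := hcentral ((y ⬝ᵥ z)⁻¹ • z) ⟨hC.smul_mem_closure hz (inv_pos.2 hp), by
      rw [dotProduct_smul, smul_eq_mul, inv_mul_cancel₀ hp.ne']⟩
    have h2 := hC.smul_mem_closure h hp
    rwa [smul_sub, smul_comm (y ⬝ᵥ z) (N : ℝ)⁻¹, smul_inv_smul₀ hp.ne'] at h2
  refine ⟨x, ?_, hyx ▸ one_pos, fun z hz => ?_⟩
  · obtain ⟨z, hz⟩ := hC.1
    have hp := hyC z hz
    have h := hC.add_mem (hC.2.2.2.1 z hz _ (inv_pos.2 hN0))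
      (hscaled z (subset_closure hz) fun h0 => by simpa [h0] using hyC z hz)
    rw [add_sub_cancel] at h
    simpa [smul_smul, hp.ne'] using hC.2.2.2.1 _ h _ (inv_pos.2 hp)
  · rw [hyx, mul_one]
    by_cases hz0 : z = 0
    · simpa [hz0] using hC.zero_mem_closure
    · exact hscaled z hz hz0

/-- The normalized functionals for which some point of a compact set is uniformly central form
a compact subset of the dual cone. -/
lemma IsProperConvexOpenCone.isCompact_central (hC : IsProperConvexOpenCone N C)
    {K : Set (Fin N → ℝ)} (hK : IsCompact K) (hKC : K ⊆ C) {δ : ℝ} (hδ : 0 < δ) :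
    {y | ∃ x ∈ K, y ⬝ᵥ x = 1 ∧ ∀ z ∈ closure C, (y ⬝ᵥ z) • x - δ • z ∈ closure C} ⊆
        dualConeSet N C ∧
      IsCompact {y | ∃ x ∈ K, y ⬝ᵥ x = 1 ∧
        ∀ z ∈ closure C, (y ⬝ᵥ z) • x - δ • z ∈ closure C} := by
  have hsub : {y | ∃ x ∈ K, y ⬝ᵥ x = 1 ∧
      ∀ z ∈ closure C, (y ⬝ᵥ z) • x - δ • z ∈ closure C} ⊆ dualConeSet N C := by
    rintro y ⟨x, hxK, -, h⟩ z hz hz0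
    by_contra! hle
    have hxC := subset_closure (hKC hxK)
    have h1 : -(y ⬝ᵥ z) • x ∈ closure C := by
      rcases hle.eq_or_lt with h0 | h0
      · simpa [h0] using hC.zero_mem_closure
      · exact hC.smul_mem_closure hxC (neg_pos.2 h0)
    have h2 := hC.smul_mem_closure (hC.add_mem_closure h1 (h z hz)) (inv_pos.2 hδ)
    rw [neg_smul, neg_add_eq_sub, sub_sub_cancel_left, smul_neg, inv_smul_smul₀ hδ.ne'] at h2
    exact hz0 (hC.eq_zero_of_neg_mem hz h2)
  refine ⟨hsub, ?_⟩
  obtain ⟨r, hr, hrC⟩ := hK.exists_cthickening_subset_open hC.2.1 hKC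
  let P : Set ((Fin N → ℝ) × (Fin N → ℝ)) := {p | p.2 ⬝ᵥ p.1 = 1 ∧
    ∀ z ∈ closure C, (p.2 ⬝ᵥ z) • p.1 - δ • z ∈ closure C}
  have hP : IsClosed P := by
    have hPeq : P = {p | p.2 ⬝ᵥ p.1 = 1} ∩
        ⋂ z ∈ closure C, {p | (p.2 ⬝ᵥ z) • p.1 - δ • z ∈ closure C} := by
      ext p
      simp [P]
    rw [hPeq]
    refine (isClosed_eq (continuous_snd.dotProduct continuous_fst) continuous_const).inter ?_
    refine isClosed_iInter fun z => isClosed_iInter fun _ => isClosed_closure.preimage ?_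
    exact ((continuous_snd.dotProduct continuous_const).smul continuous_fst).sub continuous_const
  suffices h : {y | ∃ x ∈ K, y ⬝ᵥ x = 1 ∧ ∀ z ∈ closure C, (y ⬝ᵥ z) • x - δ • z ∈ closure C} =
      Prod.snd '' (K ×ˢ Metric.closedBall (0 : Fin N → ℝ) (1 / r) ∩ P) by
    rw [h]
    exact ((hK.prod (isCompact_closedBall _ _)).inter_right hP).image continuous_snd
  ext y
  constructor
  · rintro ⟨x, hxK, hyx, h⟩
    refine ⟨(x, y), ⟨⟨hxK, ?_⟩, hyx, h⟩, rfl⟩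
    have := mul_norm_le_dotProduct (x := y) (y := x) hr fun z hz => by
      rw [dotProduct_comm]
      exact nonneg_of_mem_dualConeSet (hsub ⟨x, hxK, hyx, h⟩)
        (subset_closure (hrC (Metric.closedBall_subset_cthickening hxK r hz)))
    rw [dotProduct_comm, hyx] at this
    rwa [mem_closedBall_zero_iff, le_div_iff₀ hr, mul_comm]
  · rintro ⟨⟨x, y⟩, ⟨⟨hxK, -⟩, hyx, h⟩, rfl⟩
    exact ⟨x, hxK, hyx, h⟩

/-- Cocompactness, up to dilatation, of a family of linear maps preserving a cone passes to the
contragredient family on the dual cone. -/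
lemma IsProperConvexOpenCone.exists_compact_dual (hN : 1 ≤ N) (hC : IsProperConvexOpenCone N C)
    {ι : Type*} (A B : ι → Matrix (Fin N) (Fin N) ℝ) (hAB : ∀ i, A i * (B i)ᵀ = 1)
    (hA : ∀ i, Set.MapsTo (A i).mulVec C C) (hB : ∀ i, Set.MapsTo (B i)ᵀ.mulVec C C)
    (h : ∃ K ⊆ C, IsCompact K ∧ ∀ x ∈ C, ∃ i, ∃ s : ℝ, 0 < s ∧ ∃ k ∈ K,
      x = s • (A i).mulVec k) :
    ∃ K ⊆ dualConeSet N C, IsCompact K ∧ ∀ y ∈ dualConeSet N C, ∃ i, ∃ s : ℝ, 0 < s ∧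
      ∃ k ∈ K, y = s • (B i).mulVec k := by
  obtain ⟨K, hKC, hK, hcov⟩ := h
  have hN0 : (0 : ℝ) < N := by exact_mod_cast hN
  obtain ⟨hsub, hcomp⟩ := hC.isCompact_central hK hKC (inv_pos.2 hN0)
  refine ⟨_, hsub, hcomp, fun y hy => ?_⟩
  obtain ⟨x, hxC, hyx, hcen⟩ := hC.exists_central hN hy
  obtain ⟨i, s, hs, k, hk, rfl⟩ := hcov x hxC
  have hBA : (B i)ᵀ * A i = 1 := mul_eq_one_comm.1 (hAB i)
  have hBAt : B i * (A i)ᵀ = 1 := by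
    rw [← Matrix.transpose_transpose (B i), ← Matrix.transpose_mul, hAB, Matrix.transpose_one]
  have hadj : ∀ z, ((A i)ᵀ.mulVec y) ⬝ᵥ z = y ⬝ᵥ (A i).mulVec z := fun z => by
    rw [Matrix.mulVec_transpose, Matrix.dotProduct_mulVec]
  rw [dotProduct_smul, smul_eq_mul] at hyx
  have hp : 0 < y ⬝ᵥ (A i).mulVec k := pos_of_mul_pos_right hyx hs.le
  refine ⟨i, y ⬝ᵥ (A i).mulVec k, hp,
    (y ⬝ᵥ (A i).mulVec k)⁻¹ • (A i)ᵀ.mulVec y, ⟨k, hk, ?_, fun z hz => ?_⟩, ?_⟩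
  · rw [smul_dotProduct, hadj, smul_eq_mul, inv_mul_cancel₀ hp.ne']
  · have hAz : (A i).mulVec z ∈ closure C :=
      map_mem_closure (Continuous.matrix_mulVec continuous_const continuous_id) hz (hA i)
    have h1 := map_mem_closure (Continuous.matrix_mulVec continuous_const continuous_id)
      (hcen _ hAz) (hB i)
    have h2 := hC.smul_mem_closure h1 (inv_pos.2 hyx)
    convert h2 using 1
    simp only [id, Matrix.mulVec_sub, Matrix.mulVec_smul, Matrix.mulVec_mulVec, hBA,
      Matrix.one_mulVec, smul_sub, smul_smul, smul_dotProduct, hadj, dotProduct_smul, smul_eq_mul]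
    congr 2 <;> field_simp
  · rw [Matrix.mulVec_smul, smul_inv_smul₀ hp.ne', Matrix.mulVec_mulVec, hBAt, Matrix.one_mulVec]

/-- A matrix preserves the dual cone as soon as its transpose is injective and preserves
the cone. -/
lemma mapsTo_dualConeSet {A B : Matrix (Fin N) (Fin N) ℝ} (hAB : A * Bᵀ = 1)
    (hB : Set.MapsTo Bᵀ.mulVec C C) :
    Set.MapsTo B.mulVec (dualConeSet N C) (dualConeSet N C) := by
  intro y hy x hx hx0
  have hadj : B.mulVec y ⬝ᵥ x = y ⬝ᵥ Bᵀ.mulVec x := by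
    rw [Matrix.dotProduct_mulVec, Matrix.vecMul_transpose]
  rw [hadj]
  refine hy _ (map_mem_closure (Continuous.matrix_mulVec continuous_const continuous_id) hx hB)
    fun h => hx0 ?_
  rw [← Matrix.one_mulVec x, ← hAB, ← Matrix.mulVec_mulVec]
  exact (congrArg A.mulVec h).trans (Matrix.mulVec_zero A)

end ConeGeometry


/-- Section 6.1 of the paper, divisibility is a self-dual notion.
For a subgroup `Γ ≤ GL(N, ℝ)` preserving a properly convex open cone `C`, the central
dilatational extension of `Γ` acts cocompactly on `C` if and only if the dual group
acts cocompactly on the dual cone `C*`. -/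
theorem stmt11 (N : ℕ) (hN : 1 ≤ N) (C : Set (Fin N → ℝ))
    (hC : IsProperConvexOpenCone N C)
    (Γ : Subgroup (Matrix.GeneralLinearGroup (Fin N) ℝ))
    (hΓ : ∀ g ∈ Γ,
      (fun x => ((g : Matrix.GeneralLinearGroup (Fin N) ℝ) :
        Matrix (Fin N) (Fin N) ℝ).mulVec x) '' C = C) :
    (∃ K : Set (Fin N → ℝ), K ⊆ C ∧ IsCompact K ∧
      C = {x | ∃ g ∈ Γ, ∃ s : ℝ, 0 < s ∧ ∃ k ∈ K,
        x = s • ((g : Matrix.GeneralLinearGroup (Fin N) ℝ) :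
          Matrix (Fin N) (Fin N) ℝ).mulVec k}) ↔
    (∃ K' : Set (Fin N → ℝ), K' ⊆ dualConeSet N C ∧ IsCompact K' ∧
      dualConeSet N C = {y | ∃ g ∈ Γ, ∃ s : ℝ, 0 < s ∧ ∃ k ∈ K',
        y = s • (((g⁻¹ : Matrix.GeneralLinearGroup (Fin N) ℝ) :
          Matrix (Fin N) (Fin N) ℝ).transpose).mulVec k}) := by
  have hmaps : ∀ g ∈ Γ, Set.MapsTo (g : Matrix (Fin N) (Fin N) ℝ).mulVec C C :=
    fun g hg => Set.mapsTo_iff_image_subset.2 (hΓ g hg).subset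
  let A : Γ → Matrix (Fin N) (Fin N) ℝ := fun g => (g : GL (Fin N) ℝ)
  let B : Γ → Matrix (Fin N) (Fin N) ℝ := fun g =>
    (((g : GL (Fin N) ℝ)⁻¹ : GL (Fin N) ℝ) : Matrix (Fin N) (Fin N) ℝ)ᵀ
  have hAB : ∀ g, A g * (B g)ᵀ = 1 := fun g => by
    rw [Matrix.transpose_transpose]
    exact Units.mul_inv (g : GL (Fin N) ℝ)
  have hBA : ∀ g, B g * (A g)ᵀ = 1 := fun g => by
    rw [← Matrix.transpose_mul, ← Matrix.transpose_one]
    exact congrArg _ (Units.mul_inv (g : GL (Fin N) ℝ))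
  have hA : ∀ g, Set.MapsTo (A g).mulVec C C := fun g => hmaps g g.2
  have hB : ∀ g, Set.MapsTo (B g)ᵀ.mulVec C C := fun g => by
    rw [Matrix.transpose_transpose]
    exact hmaps _ (Γ.inv_mem g.2)
  have hB' : ∀ g, Set.MapsTo (B g).mulVec (dualConeSet N C) (dualConeSet N C) :=
    fun g => mapsTo_dualConeSet (hAB g) (hB g)
  have hA' : ∀ g, Set.MapsTo (A g)ᵀ.mulVec (dualConeSet N C) (dualConeSet N C) := fun g => by
    refine mapsTo_dualConeSet (A := (B g)ᵀ) ?_ ?_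
    · rw [Matrix.transpose_transpose]
      exact mul_eq_one_comm.1 (hAB g)
    · rw [Matrix.transpose_transpose]
      exact hA g
  constructor
  · rintro ⟨K, hKC, hK, hcov⟩
    obtain ⟨K', hK'C, hK', hcov'⟩ := hC.exists_compact_dual hN A B hAB hA hB
      ⟨K, hKC, hK, fun x hx => by
        rw [hcov] at hx
        obtain ⟨g, hg, h⟩ := hx
        exact ⟨⟨g, hg⟩, h⟩⟩
    refine ⟨K', hK'C, hK', Set.Subset.antisymm (fun y hy => ?_) ?_⟩
    · obtain ⟨g, h⟩ := hcov' y hy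
      exact ⟨g, g.2, h⟩
    · rintro _ ⟨g, hg, s, hs, k, hk, rfl⟩
      exact hC.dual.2.2.2.1 _ (hB' ⟨g, hg⟩ (hK'C hk)) s hs
  · rintro ⟨K, hKC, hK, hcov⟩
    obtain ⟨K', hK'C, hK', hcov'⟩ := hC.dual.exists_compact_dual hN B A hBA hB' hA'
      ⟨K, hKC, hK, fun x hx => by
        rw [hcov] at hx
        obtain ⟨g, hg, h⟩ := hx
        exact ⟨⟨g, hg⟩, h⟩⟩
    rw [hC.dual_dual] at hK'C hcov'
    refine ⟨K', hK'C, hK', Set.Subset.antisymm (fun y hy => ?_) ?_⟩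
    · obtain ⟨g, h⟩ := hcov' y hy
      exact ⟨g, g.2, h⟩
    · rintro _ ⟨g, hg, s, hs, k, hk, rfl⟩
      exact hC.2.2.2.1 _ (hA ⟨g, hg⟩ (hK'C hk)) s hs
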